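/- Let d be an integer with 1 ≤ d ≤ 3, let h ≥ 4 be the order of a Hadamard matrix, and let n = h + d. Then D(n)/h^{h/2} > (2n/π)^{d/2} and D̄(n) > (2/(π·e))^{d/2}. -/

import Mathlib

/-- An `h × h` Hadamard matrix: entries in `{−1, 1}` and `A * Aᵀ = h • I`. -/
def IsHadamardMatrix {h : ℕ} (A : Matrix (Fin h) (Fin h) ℝ) : Prop :=
  (∀ i j, A i j = 1 ∨ A i j = -1) ∧ A * A.transpose = (h : ℝ) • 1

/-- `h` is the order of some Hadamard matrix. -/
def IsHadamardOrder (h : ℕ) : Prop :=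
  ∃ A : Matrix (Fin h) (Fin h) ℝ, IsHadamardMatrix A

/-- `maxDet n = D(n)`: the maximum of `|det M|` over `n × n` `{±1}`-matrices `M`. -/
noncomputable def maxDet (n : ℕ) : ℝ :=
  sSup {x : ℝ | ∃ M : Matrix (Fin n) (Fin n) ℝ,
    (∀ i j, M i j = 1 ∨ M i j = -1) ∧ x = |M.det|}

/-- `maxDetBar n = D̄(n) = D(n) / n^(n/2)`. -/
noncomputable def maxDetBar (n : ℕ) : ℝ :=
  maxDet n / (n : ℝ) ^ ((n : ℝ) / 2)

section HadamardExtension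

open Finset
open scoped BigOperators

theorem sum_range_choose_mul_sub (n K : ℕ) :
    ∑ k ∈ range K, (n.choose k : ℝ) * ((n : ℝ) - 2 * k) = K * n.choose K := by
  induction K with
  | zero => simp
  | succ K ih =>
    rw [sum_range_succ, ih]
    rcases le_or_gt K n with hK | hK
    · have := Nat.choose_succ_right_eq n K
      have h2 : (n.choose (K + 1) : ℝ) * (K + 1) = n.choose K * (n - K) := by
        rw [← Nat.cast_sub hK]
        exact_mod_cast this
      push_cast
      linarith
    · rw [Nat.choose_eq_zero_of_lt hK, Nat.choose_eq_zero_of_lt (by omega)]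
      simp

theorem sum_range_choose_mul_abs_sub (m : ℕ) :
    ∑ k ∈ range (2 * m + 1), ((2 * m).choose k : ℝ) * |((2 * m : ℕ) : ℝ) - 2 * k| =
      2 * m * m.centralBinom := by
  have hlow : ∑ k ∈ range m, ((2 * m).choose k : ℝ) * |((2 * m : ℕ) : ℝ) - 2 * k| =
      m * m.centralBinom := by
    rw [Nat.centralBinom, ← sum_range_choose_mul_sub]
    refine sum_congr rfl fun k hk => ?_
    rw [abs_of_nonneg]
    have : (k : ℝ) < m := by exact_mod_cast mem_range.1 hk
    push_cast
    linarith
  rw [show 2 * m + 1 = (m + 1) + m by ring, sum_range_add, sum_range_succ, hlow]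
  have hhigh : ∑ k ∈ range m, ((2 * m).choose (m + 1 + k) : ℝ) *
      |((2 * m : ℕ) : ℝ) - 2 * (m + 1 + k : ℕ)| = m * m.centralBinom := by
    rw [← hlow, ← sum_range_reflect]
    refine sum_congr rfl fun k hk => ?_
    have hk := mem_range.1 hk
    have e : m + 1 + (m - 1 - k) = 2 * m - k := by omega
    rw [e, Nat.choose_symm (by omega), Nat.cast_sub (by omega), ← abs_neg]
    congr 2
    push_cast
    ring
  rw [hhigh]
  push_cast
  simp
  ring

/-- The Wallis product in terms of central binomial coefficients. -/
theorem wallis_mul_centralBinom (m : ℕ) :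
    Real.Wallis.W m * ((2 * m + 1) * ((m.centralBinom : ℝ) / 4 ^ m) ^ 2) = 1 := by
  induction m with
  | zero => simp [Real.Wallis.W]
  | succ m ih =>
    have h : ((m + 1).centralBinom : ℝ) = 2 * (2 * m + 1) / (m + 1) * m.centralBinom := by
      field_simp
      rw [mul_comm]
      exact_mod_cast Nat.succ_mul_centralBinom_succ m
    rw [Real.Wallis.W_succ, h]
    refine Eq.trans ?_ ih
    push_cast
    field_simp
    ring

theorem one_le_wallis (m : ℕ) : 1 ≤ Real.Wallis.W m := by
  induction m with
  | zero => simp [Real.Wallis.W]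
  | succ m ih =>
    rw [Real.Wallis.W_succ]
    refine one_le_mul_of_one_le_of_one_le ih ?_
    rw [div_mul_div_comm, one_le_div (by positivity)]
    nlinarith

section SignVec

variable {ι : Type*} [DecidableEq ι]

/-- The `±1`-vector that is `-1` exactly on `s`. -/
noncomputable def signVec (s : Finset ι) (j : ι) : ℝ := if j ∈ s then -1 else 1

theorem signVec_symmDiff (s t : Finset ι) (j : ι) :
    signVec (symmDiff s t) j = signVec s j * signVec t j := by
  by_cases h1 : j ∈ s <;> by_cases h2 : j ∈ t <;> simp [signVec, mem_symmDiff, h1, h2]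

theorem sum_signVec [Fintype ι] (s : Finset ι) :
    ∑ j, signVec s j = Fintype.card ι - 2 * #s := by
  have : ∀ j, signVec s j = 1 - 2 * if j ∈ s then 1 else 0 := by
    intro j; by_cases h : j ∈ s <;> simp [signVec, h]; norm_num
  simp [this, sum_sub_distrib, mul_comm]

theorem sum_signVec_eq_zero [Fintype ι] (j : ι) : ∑ s : Finset ι, signVec s j = 0 := by
  have h : ∑ s : Finset ι, signVec s j = ∑ s : Finset ι, signVec sᶜ j :=
    (Equiv.sum_comp (compl_involutive.toPerm _) fun s : Finset ι => signVec s j).symm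
  have h2 : ∀ s : Finset ι, signVec sᶜ j = - signVec s j := by
    intro s; by_cases h : j ∈ s <;> simp [signVec, h]
  simp only [h2, sum_neg_distrib] at h
  linarith

end SignVec

/-- A sign of `x` in `{±1}`, with the convention that the sign of `0` is `1`. -/
noncomputable def signOne (x : ℝ) : ℝ := if 0 ≤ x then 1 else -1

theorem signOne_mul_self (x : ℝ) : signOne x * x = |x| := by
  unfold signOne
  split_ifs with h
  · rw [one_mul, abs_of_nonneg h]
  · rw [abs_of_neg (not_le.1 h)]; ring

/-- `∑ |ε₁ + ⋯ + ε_h|` over all `±1` vectors. -/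
noncomputable def totalAbs (h : ℕ) : ℝ :=
  ∑ s : Finset (Fin h), |∑ j, signVec s j|

theorem sum_signOne_mul_signVec {h : ℕ} (j : Fin h) :
    h * ∑ s : Finset (Fin h), signOne (∑ i, signVec s i) * signVec s j = totalAbs h := by
  have key : ∀ k : Fin h, ∑ s : Finset (Fin h), signOne (∑ i, signVec s i) * signVec s k =
      ∑ s : Finset (Fin h), signOne (∑ i, signVec s i) * signVec s j := by
    intro k
    rw [← Equiv.sum_comp (Equiv.finsetCongr (Equiv.swap j k))]
    refine sum_congr rfl fun s _ => ?_
    congr 1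
    · simp [sum_signVec]
    · simp [signVec, mem_map_equiv]
  have h3 : ∑ k : Fin h, ∑ s : Finset (Fin h), signOne (∑ i, signVec s i) * signVec s k =
      totalAbs h := by
    rw [sum_comm]
    simp [totalAbs, ← mul_sum, signOne_mul_self]
  rw [← h3, sum_congr rfl fun k _ => key k]
  simp

theorem totalAbs_two_mul (m : ℕ) : totalAbs (2 * m) = 2 * m * m.centralBinom := by
  rw [← sum_range_choose_mul_abs_sub, totalAbs]
  have := sum_powerset_apply_card (fun k : ℕ => |((2 * m : ℕ) : ℝ) - 2 * k|)
    (x := (univ : Finset (Fin (2 * m))))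
  simp only [powerset_univ, card_univ, Fintype.card_fin, nsmul_eq_mul] at this
  rw [← this]
  simp [sum_signVec]

/-- The mean of `|ε₁ + ⋯ + ε_h|` over all `±1` vectors. -/
noncomputable def meanAbs (h : ℕ) : ℝ := totalAbs h / 2 ^ h

theorem meanAbs_nonneg (h : ℕ) : 0 ≤ meanAbs h :=
  div_nonneg (sum_nonneg fun _ _ => abs_nonneg _) (by positivity)

theorem meanAbs_two_mul_sq (m : ℕ) :
    meanAbs (2 * m) ^ 2 = (2 * m) ^ 2 / ((2 * m + 1) * Real.Wallis.W m) := by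
  have hW := Real.Wallis.W_pos m
  have h4 : (2 : ℝ) ^ (2 * m) = 4 ^ m := by rw [pow_mul]; norm_num
  rw [eq_div_iff (by positivity), meanAbs, totalAbs_two_mul, h4]
  linear_combination (2 * (m : ℝ)) ^ 2 * wallis_mul_centralBinom m

theorem meanAbs_sq_le {h : ℕ} (he : Even h) : meanAbs h ^ 2 ≤ h := by
  obtain ⟨m, rfl⟩ := even_iff_two_dvd.1 he
  have hW := one_le_wallis m
  rw [meanAbs_two_mul_sq, div_le_iff₀ (by positivity)]
  push_cast
  have hm : (0 : ℝ) ≤ m := by positivity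
  nlinarith [mul_le_mul_of_nonneg_left hW (show (0 : ℝ) ≤ 2 * m * (2 * m + 1) by positivity)]

theorem le_meanAbs_sq {h : ℕ} (he : Even h) :
    2 / Real.pi * (h ^ 2 / (h + 1)) ≤ meanAbs h ^ 2 := by
  obtain ⟨m, rfl⟩ := even_iff_two_dvd.1 he
  have hW := Real.Wallis.W_pos m
  have hW' := Real.Wallis.W_le m
  have hpi := Real.pi_pos
  rw [meanAbs_two_mul_sq, div_mul_div_comm]
  push_cast
  rw [div_le_div_iff₀ (by positivity) (by positivity)]
  have : (0 : ℝ) ≤ (2 * m) ^ 2 * (2 * m + 1) := by positivity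
  nlinarith [mul_le_mul_of_nonneg_left hW' this]

theorem lt_meanAbs_add_one_sq {h : ℕ} (he : Even h) (hh : 4 ≤ h) :
    2 / Real.pi * (h + 3) < (meanAbs h + 1) ^ 2 := by
  have hlow := le_meanAbs_sq he
  have hg := meanAbs_nonneg h
  have hpi := Real.pi_gt_three
  have hpi' := Real.pi_le_four
  have hh' : (4 : ℝ) ≤ h := by exact_mod_cast hh
  have hx : 2 / Real.pi ≤ 2 / 3 := by gcongr
  have hx' : 1 / 2 ≤ 2 / Real.pi := by rw [div_le_div_iff₀ (by norm_num) (by positivity)]; linarith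
  have e : (h : ℝ) ^ 2 / (h + 1) = h - 1 + 1 / (h + 1) := by field_simp; ring
  have h1 : (0 : ℝ) < 1 / (h + 1) := by positivity
  rw [e] at hlow
  have hg1 : 1 < meanAbs h := by
    by_contra! hcon
    have : meanAbs h ^ 2 ≤ 1 := pow_le_one₀ hg hcon
    nlinarith [mul_le_mul_of_nonneg_right hx' (show (0 : ℝ) ≤ h - 1 by linarith)]
  nlinarith [mul_pos (show (0 : ℝ) < 2 / Real.pi by positivity) h1]

/-- A kernel on a finite uniform probability space with mean zero in its second argument, diagonal
mean `g`, and such that averaging over the middle point composes `F` with itself to `κ * F`. -/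
structure IsReproducing {Ω : Type*} [Fintype Ω] (F : Ω → Ω → ℝ) (g κ : ℝ) : Prop where
  right_mean : ∀ a, 𝔼 b, F a b = 0
  diag_mean : 𝔼 a, F a a = g
  comp_mean : ∀ a c, 𝔼 b, F a b * F b c = κ * F a c

theorem exists_expect_le {Ω : Type*} [Fintype Ω] [Nonempty Ω] (f : Ω → ℝ) :
    ∃ a, 𝔼 b, f b ≤ f a := by
  obtain ⟨a, -, ha⟩ := exists_le_of_le_expect (univ_nonempty (α := Ω)) (le_refl (𝔼 b, f b))
  exact ⟨a, ha⟩

namespace IsReproducing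

variable {Ω : Type*} [Fintype Ω] {F : Ω → Ω → ℝ} {g κ : ℝ}

theorem expect_left_mul (hF : IsReproducing F g κ) (u : Ω → ℝ) :
    𝔼 a, 𝔼 b, F b a * u b = 0 := by
  rw [expect_comm]
  simp [← expect_mul, hF.right_mean]

variable [Nonempty Ω]

/-- The right-hand side is the determinant of the `2 × 2` matrix `F` plus a skew `±1` pattern. -/
theorem exists_two (hF : IsReproducing F g κ) :
    ∃ a b, (g + 1) ^ 2 - κ * g + 1 ≤ (F a a + 1) * (F b b + 1) - (F a b - 1) * (F b a + 1) := by
  have hr : 𝔼 a, 𝔼 b, F b a = 0 := by simpa using hF.expect_left_mul fun _ => 1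
  have hb : ∀ a, 𝔼 b, ((F a a + 1) * (F b b + 1) - (F a b - 1) * (F b a + 1)) =
      (F a a + 1) * (g + 1) - κ * F a a + (𝔼 b, F b a) + 1 := by
    intro a
    have e : ∀ b, (F a a + 1) * (F b b + 1) - (F a b - 1) * (F b a + 1) =
        (F a a + 2) + (F a a + 1) * F b b + (-1) * (F a b * F b a) + (-1) * F a b + F b a := by
      intro b; ring
    simp only [e, expect_add_distrib, ← mul_expect, hF.right_mean, hF.diag_mean, hF.comp_mean,
      expect_const univ_nonempty]
    ring
  have ha : 𝔼 a, ((F a a + 1) * (g + 1) - κ * F a a + (𝔼 b, F b a) + 1) =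
      (g + 1) ^ 2 - κ * g + 1 := by
    have e : ∀ a, (F a a + 1) * (g + 1) - κ * F a a + (𝔼 b, F b a) + 1 =
        (g + 2) + (g + 1 - κ) * F a a + 𝔼 b, F b a := by
      intro a; ring
    simp only [e, expect_add_distrib, ← mul_expect, hF.diag_mean, hr, expect_const univ_nonempty]
    ring
  obtain ⟨a, h1⟩ := exists_expect_le
    fun a => (F a a + 1) * (g + 1) - κ * F a a + (𝔼 b, F b a) + 1
  obtain ⟨b, h2⟩ := exists_expect_le fun b =>
    (F a a + 1) * (F b b + 1) - (F a b - 1) * (F b a + 1)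
  rw [ha] at h1
  rw [hb] at h2
  exact ⟨a, b, h1.trans h2⟩

/-- The right-hand side is the determinant of the `3 × 3` matrix `F` plus a skew `±1` pattern. -/
theorem exists_three (hF : IsReproducing F g κ) :
    ∃ a b c, (g + 1) ^ 3 + 3 * (g + 1) - 3 * (g + 1) * (κ * g) + 2 * (κ ^ 2 * g) ≤
      ((F a a + 1) * (F b b + 1) - (F a b - 1) * (F b a + 1)) * (F c c + 1)
        - (F a a + 1) * ((F b c - 1) * (F c b + 1)) + (F a b - 1) * ((F b c - 1) * (F c a + 1))
        + (F b a + 1) * ((F a c - 1) * (F c b + 1))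
        - (F b b + 1) * ((F a c - 1) * (F c a + 1)) := by
  set r : Ω → ℝ := fun a => 𝔼 b, F b a with hr_def
  set s : Ω → ℝ := fun a => 𝔼 b, F b a * r b with hs_def
  have hr : 𝔼 a, r a = 0 := by simpa using hF.expect_left_mul fun _ => 1
  have hs : 𝔼 a, s a = 0 := hF.expect_left_mul r
  have hr' : ∀ a, 𝔼 b, F b a = r a := fun a => rfl
  have hs' : ∀ a, 𝔼 b, F b a * r b = s a := fun a => rfl
  clear_value r s
  set P : Ω → Ω → Ω → ℝ := fun a b c =>
      ((F a a + 1) * (F b b + 1) - (F a b - 1) * (F b a + 1)) * (F c c + 1)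
        - (F a a + 1) * ((F b c - 1) * (F c b + 1)) + (F a b - 1) * ((F b c - 1) * (F c a + 1))
        + (F b a + 1) * ((F a c - 1) * (F c b + 1))
        - (F b b + 1) * ((F a c - 1) * (F c a + 1)) with hP
  set Q : Ω → Ω → ℝ := fun a b =>
    ((F a a + 1) * (F b b + 1) - (F a b - 1) * (F b a + 1)) * (g + 1)
      - (F a a + 1) * (κ * F b b - r b - 1) + (F a b - 1) * (κ * F b a - r a - 1)
      + (F b a + 1) * (κ * F a b - r b - 1) - (F b b + 1) * (κ * F a a - r a - 1) with hQ
  set R : Ω → ℝ := fun a =>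
    (F a a + 1) * (g + 1) ^ 2 - (κ * F a a - r a - 1) * (g + 1) - (F a a + 1) * (κ * g - 1)
      + (κ * (κ * F a a) - κ * r a + r a + 1)
      + (κ * (κ * F a a) - s a - r a - 1)
      - (g + 1) * (κ * F a a - r a - 1) with hR
  have hc : ∀ a b, 𝔼 c, P a b c = Q a b := by
    intro a b
    have e : ∀ c, P a b c =
        ((F a a + 1) * (F b b + 1) - (F a b - 1) * (F b a + 1)
          + (F a a + 1) - (F a b - 1) - (F b a + 1) + (F b b + 1))
        + ((F a a + 1) * (F b b + 1) - (F a b - 1) * (F b a + 1)) * F c c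
        + (-(F a a + 1)) * (F b c * F c b) + (F a b - 1) * (F b c * F c a)
        + (F b a + 1) * (F a c * F c b) + (-(F b b + 1)) * (F a c * F c a)
        + (F a b - F a a - 2) * F b c + (F b a - F b b) * F a c
        + (F a a - F b a) * F c b + (F b b + 1 - F a b + 1) * F c a := by
      intro c; simp only [hP]; ring
    simp only [e, expect_add_distrib, ← mul_expect, hF.right_mean, hF.diag_mean, hF.comp_mean,
      expect_const univ_nonempty, hr', hQ]
    ring
  have hb : ∀ a, 𝔼 b, Q a b = R a := by
    intro a
    have e : ∀ b, Q a b =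
        ((F a a + 1) * (g + 1) + (g + 1) + (F a a + 1) + r a - (κ * F a a - r a - 1))
        + ((F a a + 1) * (g + 1) - (F a a + 1) * κ - (κ * F a a - r a - 1)) * F b b
        + (κ - (g + 1) - (r a + 1)) * F a b + (g - κ) * F b a + F a a * r b
        + (2 * κ - (g + 1)) * (F a b * F b a) + (-1) * (F b a * r b) := by
      intro b; simp only [hQ]; ring
    simp only [e, expect_add_distrib, ← mul_expect, hF.right_mean, hF.diag_mean, hF.comp_mean,
      expect_const univ_nonempty, hr', hs', hr, hR]
    ring
  have ha : 𝔼 a, R a =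
      (g + 1) ^ 3 + 3 * (g + 1) - 3 * (g + 1) * (κ * g) + 2 * (κ ^ 2 * g) := by
    have e : ∀ a, R a = ((g + 1) ^ 2 + 2 * (g + 1) + 1 - κ * g)
        + ((g + 1) ^ 2 - 2 * κ * (g + 1) - κ * g + 1 + 2 * κ ^ 2) * F a a
        + (2 * (g + 1) - κ) * r a + (-1) * s a := by
      intro a; simp only [hR]; ring
    simp only [e, expect_add_distrib, ← mul_expect, hF.diag_mean, hr, hs,
      expect_const univ_nonempty]
    ring
  obtain ⟨a, h1⟩ := exists_expect_le R
  obtain ⟨b, h2⟩ := exists_expect_le (Q a)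
  obtain ⟨c, h3⟩ := exists_expect_le (P a b)
  rw [ha] at h1
  rw [hb] at h2
  rw [hc] at h3
  exact ⟨a, b, c, h1.trans (h2.trans h3)⟩

end IsReproducing

theorem signOne_eq (x : ℝ) : signOne x = 1 ∨ signOne x = -1 := by
  unfold signOne; split_ifs <;> simp

theorem signVec_eq {ι : Type*} [DecidableEq ι] (s : Finset ι) (j : ι) :
    signVec s j = 1 ∨ signVec s j = -1 := by
  unfold signVec; split_ifs <;> simp

theorem expect_signOne_mul_signVec {h : ℕ} (j : Fin h) :
    h * 𝔼 s : Finset (Fin h), signOne (∑ i, signVec s i) * signVec s j = meanAbs h := by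
  rw [meanAbs, ← sum_signOne_mul_signVec j, Fintype.expect_eq_sum_div_card]
  simp [mul_div_assoc]

namespace IsHadamardMatrix

variable {h : ℕ} {A : Matrix (Fin h) (Fin h) ℝ}

theorem transpose_mul_self (hA : IsHadamardMatrix A) (hh : 0 < h) :
    A.transpose * A = (h : ℝ) • 1 := by
  have hne : (h : ℝ) ≠ 0 := by positivity
  have h1 : A * ((h : ℝ)⁻¹ • A.transpose) = 1 := by
    rw [Matrix.mul_smul, hA.2, smul_smul, inv_mul_cancel₀ hne, one_smul]
  have h2 := mul_eq_one_comm.1 h1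
  rw [Matrix.smul_mul] at h2
  rw [← h2, smul_smul, mul_inv_cancel₀ hne, one_smul]

theorem even_order (hA : IsHadamardMatrix A) (hh : 2 ≤ h) : Even h := by
  have h0 := congrFun (congrFun hA.2 ⟨0, by omega⟩) ⟨1, by omega⟩
  rw [Matrix.mul_apply] at h0
  have hs : ∀ j, A ⟨0, by omega⟩ j * A ⟨1, by omega⟩ j =
      signVec (univ.filter fun j => A ⟨0, by omega⟩ j ≠ A ⟨1, by omega⟩ j) j := by
    intro j
    rcases hA.1 ⟨0, by omega⟩ j with h1 | h1 <;> rcases hA.1 ⟨1, by omega⟩ j with h2 | h2 <;>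
      (simp [signVec, h1, h2]; try norm_num)
  simp only [Matrix.transpose_apply, hs, sum_signVec] at h0
  simp only [Fintype.card_fin, Matrix.smul_apply, Matrix.one_apply, Fin.mk.injEq, zero_ne_one,
    if_false, smul_zero, sub_eq_zero] at h0
  exact even_iff_two_dvd.2 ⟨_, by exact_mod_cast h0⟩

/-- The set of rows where column `k` is `-1`. -/
noncomputable def negRows (A : Matrix (Fin h) (Fin h) ℝ) (k : Fin h) : Finset (Fin h) :=
  univ.filter fun j => A j k = -1

theorem signVec_negRows (hA : IsHadamardMatrix A) (j k : Fin h) :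
    signVec (negRows A k) j = A j k := by
  rcases hA.1 j k with h1 | h1 <;> simp [signVec, negRows, h1]
  norm_num

theorem expect_sign_mul_signVec (hA : IsHadamardMatrix A) (j k : Fin h) :
    h * 𝔼 s : Finset (Fin h), signOne (∑ i, A i k * signVec s i) * signVec s j =
      A j k * meanAbs h := by
  rw [← expect_signOne_mul_signVec j, mul_left_comm, mul_expect (a := A j k)]
  congr 1
  refine Fintype.expect_equiv ((symmDiff_left_involutive (negRows A k)).toPerm _) _ _ fun s => ?_
  have hsq : A j k * A j k = 1 := by rcases hA.1 j k with h1 | h1 <;> simp [h1]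
  simp only [Function.Involutive.coe_toPerm, signVec_symmDiff, hA.signVec_negRows]
  simp only [mul_comm (signVec s _) (A _ _)]
  linear_combination (-(signOne (∑ i, A i k * signVec s i) * signVec s j)) * hsq

theorem expect_sign_mul (hA : IsHadamardMatrix A) (hh : 0 < h) (k l : Fin h) :
    𝔼 s : Finset (Fin h), signOne (∑ i, A i k * signVec s i) * ∑ j, A j l * signVec s j =
      if k = l then meanAbs h else 0 := by
  have hne : (h : ℝ) ≠ 0 := by positivity
  have h1 : (∑ j, A j k * A j l) = if k = l then (h : ℝ) else 0 := by
    have := congrFun (congrFun (hA.transpose_mul_self hh) k) l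
    rw [Matrix.mul_apply] at this
    simpa [Matrix.one_apply] using this
  apply mul_left_cancel₀ hne
  calc _ = ∑ j, A j l * (h * 𝔼 s : Finset (Fin h),
        signOne (∑ i, A i k * signVec s i) * signVec s j) := by
        simp only [mul_sum, expect_sum_comm, mul_expect]
        refine sum_congr rfl fun j _ => expect_congr rfl fun s _ => ?_
        ring
    _ = (∑ j, A j k * A j l) * meanAbs h := by
        simp only [hA.expect_sign_mul_signVec, sum_mul]
        refine sum_congr rfl fun j _ => ?_
        ring
    _ = _ := by rw [h1]; split_ifs <;> simp

/-- The entries of `C * A⁻¹ * B`, for a column of `B` given by `b` and a row of `C` given by the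
signs of `Aᵀ a`. -/
noncomputable def kernel (A : Matrix (Fin h) (Fin h) ℝ) (a b : Finset (Fin h)) : ℝ :=
  (h : ℝ)⁻¹ * ∑ k, signOne (∑ i, A i k * signVec a i) * ∑ j, A j k * signVec b j

theorem isReproducing_kernel (hA : IsHadamardMatrix A) (hh : 0 < h) :
    IsReproducing (kernel A) (meanAbs h) (meanAbs h / h) where
  right_mean a := by
    have h0 : ∀ j : Fin h, 𝔼 b : Finset (Fin h), signVec b j = 0 := fun j => by
      rw [Fintype.expect_eq_sum_div_card, sum_signVec_eq_zero, zero_div]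
    simp [kernel, ← mul_expect, expect_sum_comm, h0]
  diag_mean := by
    have hne : (h : ℝ) ≠ 0 := by positivity
    simp [kernel, ← mul_expect, expect_sum_comm, hA.expect_sign_mul hh, hne]
  comp_mean a c := by
    have e : ∀ b, kernel A a b * kernel A b c = ∑ k, ∑ l, ((h : ℝ)⁻¹ * (h : ℝ)⁻¹ *
        signOne (∑ i, A i k * signVec a i) * ∑ j, A j l * signVec c j) *
        (signOne (∑ i, A i l * signVec b i) * ∑ j, A j k * signVec b j) := by
      intro b
      rw [kernel, kernel, mul_mul_mul_comm, sum_mul_sum, mul_sum]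
      refine sum_congr rfl fun k _ => ?_
      rw [mul_sum]
      refine sum_congr rfl fun l _ => ?_
      ring
    simp only [e, expect_sum_comm, ← mul_expect, hA.expect_sign_mul hh]
    simp only [mul_ite, mul_zero, sum_ite_eq', mem_univ, if_true, kernel, mul_sum]
    refine sum_congr rfl fun k _ => ?_
    rw [← mul_sum, ← mul_sum, ← mul_sum, ← mul_sum]
    ring

theorem abs_det (hA : IsHadamardMatrix A) : |A.det| = (h : ℝ) ^ ((h : ℝ) / 2) := by
  have h1 : A.det ^ 2 = (h : ℝ) ^ h := by
    have := congrArg Matrix.det hA.2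
    rw [Matrix.det_mul, Matrix.det_transpose, Matrix.det_smul] at this
    simpa [sq] using this
  have h2 : ((h : ℝ) ^ ((h : ℝ) / 2)) ^ 2 = (h : ℝ) ^ h := by
    rw [← Real.rpow_natCast, ← Real.rpow_mul (by positivity)]
    norm_num
  rw [← abs_of_nonneg (show 0 ≤ (h : ℝ) ^ ((h : ℝ) / 2) by positivity), ← sq_eq_sq_iff_abs_eq_abs,
    h1, h2]

end IsHadamardMatrix

theorem abs_det_le_maxDet {n : ℕ} (M : Matrix (Fin n) (Fin n) ℝ)
    (hM : ∀ i j, M i j = 1 ∨ M i j = -1) : |M.det| ≤ maxDet n := by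
  refine le_csSup ⟨n.factorial, ?_⟩ ⟨M, hM, rfl⟩
  rintro x ⟨N, hN, rfl⟩
  have := Matrix.det_le (A := N) (abv := AbsoluteValue.abs) (x := 1) fun i j => by
    rcases hN i j with h | h <;> simp [h]
  simpa using this

theorem IsHadamardMatrix.mul_abs_det_le_maxDet {h d : ℕ} {A : Matrix (Fin h) (Fin h) ℝ}
    (hA : IsHadamardMatrix A) (hh : 0 < h) (b : Fin d → Finset (Fin h))
    (D : Matrix (Fin d) (Fin d) ℝ) (hD : ∀ i j, D i j = 1 ∨ D i j = -1) :
    (h : ℝ) ^ ((h : ℝ) / 2) * |(D - Matrix.of fun i j => kernel A (b i) (b j)).det| ≤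
      maxDet (h + d) := by
  have hne : (h : ℝ) ≠ 0 := by positivity
  let B : Matrix (Fin h) (Fin d) ℝ := Matrix.of fun i j => signVec (b j) i
  let C : Matrix (Fin d) (Fin h) ℝ := Matrix.of fun i k => signOne (∑ j, A j k * signVec (b i) j)
  have h1 : A * ((h : ℝ)⁻¹ • A.transpose) = 1 := by
    rw [Matrix.mul_smul, hA.2, smul_smul, inv_mul_cancel₀ hne, one_smul]
  let _ : Invertible A := ⟨(h : ℝ)⁻¹ • A.transpose, mul_eq_one_comm.1 h1, h1⟩
  have hinv : ⅟A = (h : ℝ)⁻¹ • A.transpose := rfl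
  have hF : C * ⅟A * B = Matrix.of fun i j => kernel A (b i) (b j) := by
    ext i j
    rw [hinv, Matrix.mul_smul, Matrix.smul_mul, Matrix.mul_assoc]
    simp [kernel, Matrix.mul_apply, B, C]
  have key := abs_det_le_maxDet
    ((Matrix.fromBlocks A B C D).submatrix finSumFinEquiv.symm finSumFinEquiv.symm) (by
      intro i j
      rw [Matrix.submatrix_apply]
      rcases finSumFinEquiv.symm i with i | i <;> rcases finSumFinEquiv.symm j with j | j
      · exact hA.1 i j
      · exact signVec_eq _ _
      · exact signOne_eq _
      · exact hD i j)
  rwa [Matrix.det_submatrix_equiv_self, Matrix.det_fromBlocks₁₁, hF, abs_mul, hA.abs_det] at key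

theorem IsHadamardMatrix.pow_le_maxDet {h d : ℕ} {A : Matrix (Fin h) (Fin h) ℝ}
    (hA : IsHadamardMatrix A) (hh : 4 ≤ h) (hd1 : 1 ≤ d) (hd3 : d ≤ 3) :
    (h : ℝ) ^ ((h : ℝ) / 2) * (meanAbs h + 1) ^ d ≤ maxDet (h + d) := by
  have h0 : 0 < h := by omega
  have hF := hA.isReproducing_kernel h0
  have hg := meanAbs_nonneg h
  have hκ : meanAbs h / h * meanAbs h ≤ 1 := by
    have := meanAbs_sq_le (hA.even_order (by omega))
    rw [div_mul_eq_mul_div, div_le_one (by positivity)]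
    nlinarith
  suffices ∃ (b : Fin d → Finset (Fin h)) (D : Matrix (Fin d) (Fin d) ℝ),
      (∀ i j, D i j = 1 ∨ D i j = -1) ∧
      (meanAbs h + 1) ^ d ≤ |(D - Matrix.of fun i j => kernel A (b i) (b j)).det| by
    obtain ⟨b, D, hD, hle⟩ := this
    exact (mul_le_mul_of_nonneg_left hle (by positivity)).trans
      (hA.mul_abs_det_le_maxDet h0 b D hD)
  interval_cases d
  · obtain ⟨a, ha⟩ := exists_expect_le fun a => kernel A a a
    rw [hF.diag_mean] at ha
    refine ⟨![a], !![-1], by simp, ?_⟩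
    rw [Matrix.det_fin_one, ← abs_neg]
    refine le_trans ?_ (le_abs_self _)
    simp
    linarith
  · obtain ⟨a, b, hab⟩ := hF.exists_two
    refine ⟨![a, b], !![-1, 1; -1, -1], by simp [Fin.forall_fin_two], ?_⟩
    rw [Matrix.det_fin_two]
    refine le_trans ?_ (le_abs_self _)
    simp
    linarith
  · obtain ⟨a, b, c, habc⟩ := hF.exists_three
    refine ⟨![a, b, c], !![-1, 1, 1; -1, -1, 1; -1, -1, -1], ?_, ?_⟩
    · intro i j; fin_cases i <;> fin_cases j <;> simp
    rw [Matrix.det_fin_three, ← abs_neg]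
    refine le_trans ?_ (le_abs_self _)
    have h1 : 0 ≤ 3 * (meanAbs h + 1) * (1 - meanAbs h / h * meanAbs h) :=
      mul_nonneg (by positivity) (by linarith)
    have h2 : 0 ≤ 2 * ((meanAbs h / h) ^ 2 * meanAbs h) := by positivity
    simp
    linarith

theorem exp_neg_half_le_rpow {h d : ℕ} (hh : 0 < h) :
    Real.exp 1 ^ (-((d : ℝ) / 2)) ≤ ((h : ℝ) / (h + d)) ^ ((h : ℝ) / 2) := by
  have hpos : (0 : ℝ) < h := by positivity
  have h1 : ((h + d : ℝ) / h) ^ ((h : ℝ) / 2) ≤ Real.exp 1 ^ ((d : ℝ) / 2) := by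
    calc ((h + d : ℝ) / h) ^ ((h : ℝ) / 2) ≤ Real.exp (d / h) ^ ((h : ℝ) / 2) := by
          gcongr
          rw [add_div, div_self hpos.ne', add_comm]
          exact Real.add_one_le_exp _
      _ = Real.exp 1 ^ ((d : ℝ) / 2) := by
          rw [← Real.exp_mul, ← Real.exp_mul]
          congr 1
          field_simp
  rw [Real.rpow_neg (by positivity), ← inv_div (h + d : ℝ), Real.inv_rpow (by positivity)]
  gcongr

end HadamardExtension

theorem maxDet_lower_bound_small_d (d h n : ℕ) (hd1 : 1 ≤ d) (hd3 : d ≤ 3)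
    (hH : IsHadamardOrder h) (hh : 4 ≤ h) (hn : n = h + d) :
    maxDet n / (h : ℝ) ^ ((h : ℝ) / 2) > (2 * (n : ℝ) / Real.pi) ^ ((d : ℝ) / 2) ∧
    maxDetBar n > (2 / (Real.pi * Real.exp 1)) ^ ((d : ℝ) / 2) := by
  obtain ⟨A, hA⟩ := hH
  have hpi := Real.pi_pos
  have hg := meanAbs_nonneg h
  have hhpos : (0 : ℝ) < h := by positivity
  have hnpos : (0 : ℝ) < n := by rw [hn]; positivity
  have hP : (0 : ℝ) < (h : ℝ) ^ ((h : ℝ) / 2) := by positivity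
  have hle := IsHadamardMatrix.pow_le_maxDet hA hh hd1 hd3
  have hlt : (2 * (n : ℝ) / Real.pi) ^ ((d : ℝ) / 2) <
      (meanAbs h + 1) ^ d := by
    have h1 : 2 * (n : ℝ) / Real.pi < (meanAbs h + 1) ^ 2 := by
      refine lt_of_le_of_lt ?_ (lt_meanAbs_add_one_sq
        (IsHadamardMatrix.even_order hA (by omega)) hh)
      have : (n : ℝ) ≤ h + 3 := by rw [hn]; exact_mod_cast Nat.add_le_add_left hd3 h
      rw [mul_div_right_comm]
      gcongr
    calc _ < ((meanAbs h + 1) ^ 2) ^ ((d : ℝ) / 2) :=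
          Real.rpow_lt_rpow (by positivity) h1 (by positivity)
      _ = _ := by
          rw [← Real.rpow_natCast, ← Real.rpow_natCast, ← Real.rpow_mul (by positivity)]
          congr 1
          push_cast
          ring
  rw [← hn] at hle
  have first : (2 * (n : ℝ) / Real.pi) ^ ((d : ℝ) / 2) < maxDet n / (h : ℝ) ^ ((h : ℝ) / 2) := by
    rw [lt_div_iff₀' hP]
    exact (mul_lt_mul_of_pos_left hlt hP).trans_le hle
  refine ⟨first, ?_⟩
  rw [lt_div_iff₀' hP] at first
  rw [gt_iff_lt, maxDetBar, lt_div_iff₀ (by positivity)]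
  refine lt_of_le_of_lt ?_ first
  have hexp := exp_neg_half_le_rpow (h := h) (d := d) (by omega)
  have hn' : (h : ℝ) + d = n := by rw [hn]; push_cast; ring
  rw [hn', Real.div_rpow (by positivity) (by positivity), le_div_iff₀ (by positivity)] at hexp
  have e1 : (2 / (Real.pi * Real.exp 1)) ^ ((d : ℝ) / 2) =
      (2 / Real.pi) ^ ((d : ℝ) / 2) * Real.exp 1 ^ (-((d : ℝ) / 2)) := by
    rw [Real.rpow_neg (by positivity), ← Real.inv_rpow (by positivity),
      ← Real.mul_rpow (by positivity) (by positivity)]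
    congr 1
    field_simp
  have e2 : (n : ℝ) ^ ((n : ℝ) / 2) = (n : ℝ) ^ ((h : ℝ) / 2) * (n : ℝ) ^ ((d : ℝ) / 2) := by
    rw [← Real.rpow_add hnpos, ← add_div, hn']
  have e3 : (2 * (n : ℝ) / Real.pi) ^ ((d : ℝ) / 2) =
      (2 / Real.pi) ^ ((d : ℝ) / 2) * (n : ℝ) ^ ((d : ℝ) / 2) := by
    rw [← Real.mul_rpow (by positivity) (by positivity)]
    congr 1
    ring
  rw [e1, e2, e3]
  calc _ = (Real.exp 1 ^ (-((d : ℝ) / 2)) * (n : ℝ) ^ ((h : ℝ) / 2)) *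
        ((2 / Real.pi) ^ ((d : ℝ) / 2) * (n : ℝ) ^ ((d : ℝ) / 2)) := by ring
    _ ≤ _ := by gcongr
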